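/- Suppose e is a positive edge battery [e, C, +] in a signed block Σ and C has exactly two bridges. If both bridges are paths, every edge in either bridge lies in a unique positive circle; if at least one bridge is not a path, no edge in either bridge lies in a unique positive circle. -/

import Mathlib

open SimpleGraph Finset

variable {V : Type*} [DecidableEq V]

/-- The sign (product of edge signs) of a finite set of edges. -/
def esign (σ : Sym2 V → ℤˣ) (s : Finset (Sym2 V)) : ℤˣ := ∏ e ∈ s, σ e

/-- The sign of a walk: the product of the signs of its edges. -/
def wsign (σ : Sym2 V → ℤˣ) {G : SimpleGraph V} {u v : V} (w : G.Walk u v) : ℤˣ :=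
  (w.edges.map σ).prod

/-- `s` is the edge set of a circle (cycle) of `G`. -/
def IsCircleOf (G : SimpleGraph V) (s : Finset (Sym2 V)) : Prop :=
  ∃ (a : V) (w : G.Walk a a), w.IsCycle ∧ w.edges.toFinset = s

/-- The signature obtained from `σ` by switching with `ζ`. -/
def switchSign (σ : Sym2 V → ℤˣ) (ζ : V → ℤˣ) : Sym2 V → ℤˣ :=
  fun e => Sym2.lift ⟨fun a b => ζ a * σ s(a, b) * ζ b, by
    intro a b
    simp only []
    rw [Sym2.eq_swap]
    simp [mul_comm, mul_assoc, mul_left_comm]⟩ e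

/-- `b` is a balancing edge: one can switch so that `b` is the unique negative edge. -/
def IsBalancingEdge (G : SimpleGraph V) (σ : Sym2 V → ℤˣ) (b : Sym2 V) : Prop :=
  b ∈ G.edgeSet ∧ ∃ ζ : V → ℤˣ, ∀ f ∈ G.edgeSet, (switchSign σ ζ f = -1 ↔ f = b)

/-- `F` is the edge set of a bridge of the circle `w` in `G`: either a single
chord of `w`, or the edge set attached to a connected component of `G` minus
the vertices of `w`. -/
def IsBridgeOf {a : V} (G : SimpleGraph V) (w : G.Walk a a) (F : Set (Sym2 V)) : Prop :=
  (∃ x y : V, x ≠ y ∧ x ∈ w.support ∧ y ∈ w.support ∧ G.Adj x y ∧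
      s(x, y) ∉ w.edges ∧ F = {s(x, y)}) ∨
  (∃ D : Set V, D.Nonempty ∧ (∀ x ∈ D, x ∉ w.support) ∧ (G.induce D).Connected ∧
      (∀ x ∈ D, ∀ y : V, G.Adj x y → y ∈ D ∨ y ∈ w.support) ∧
      F = {e | e ∈ G.edgeSet ∧ ∃ x ∈ D, x ∈ e})

/-- The vertices of attachment of a bridge with edge set `F`. -/
def attachments {a : V} (G : SimpleGraph V) (w : G.Walk a a) (F : Set (Sym2 V)) : Set V :=
  {x | x ∈ w.support ∧ ∃ e ∈ F, x ∈ e}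

/-- A path through a bridge: a path between two distinct vertices of attachment
all of whose edges lie in the bridge. -/
def IsPathThrough {a : V} (G : SimpleGraph V) (w : G.Walk a a) (F : Set (Sym2 V))
    {x y : V} (Q : G.Walk x y) : Prop :=
  x ≠ y ∧ x ∈ attachments G w F ∧ y ∈ attachments G w F ∧ Q.IsPath ∧
    ∀ e ∈ Q.edges, e ∈ F

/-- `G` is a block: it is connected and has no cutpoint. -/
def IsBlock (G : SimpleGraph V) : Prop :=
  G.Connected ∧ ∀ v : V, ((⊤ : G.Subgraph).deleteVerts {v}).coe.Connected

set_option linter.unusedSectionVars false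

section CycleSpace

/-- In a commutative monoid of exponent two, products are multiplicative for symmetric
differences. -/
@[to_additive]
lemma Finset.prod_symmDiff_of_mul_self {ι M : Type*} [DecidableEq ι] [CommMonoid M] (f : ι → M)
    (hf : ∀ i, f i * f i = 1) (s t : Finset ι) :
    ∏ i ∈ symmDiff s t, f i = (∏ i ∈ s, f i) * ∏ i ∈ t, f i := by
  have hd : Disjoint (s \ t) (t \ s) := disjoint_sdiff_sdiff
  have h : (∏ i ∈ s ∩ t, f i) * ∏ i ∈ s ∩ t, f i = 1 := by
    rw [← Finset.prod_mul_distrib]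
    exact Finset.prod_eq_one fun i _ => hf i
  rw [symmDiff_def, Finset.sup_eq_union, Finset.prod_union hd,
    ← Finset.prod_inter_mul_prod_sdiff s t, ← Finset.prod_inter_mul_prod_sdiff t s,
    Finset.inter_comm t s, mul_mul_mul_comm, h, one_mul]

lemma ZMod.pi_add_self {ι : Type*} (f : ι → ZMod 2) : f + f = 0 :=
  funext fun _ => CharTwo.add_self_eq_zero _

lemma esign_symmDiff (σ : Sym2 V → ℤˣ) (s t : Finset (Sym2 V)) :
    esign σ (symmDiff s t) = esign σ s * esign σ t :=
  Finset.prod_symmDiff_of_mul_self σ (fun _ => Int.units_mul_self _) s t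

/-- The degree modulo two of the vertex `v` in the edge set `s`. -/
def edgeBoundary (s : Finset (Sym2 V)) (v : V) : ZMod 2 := ∑ e ∈ s, if v ∈ e then 1 else 0

lemma edgeBoundary_symmDiff (s t : Finset (Sym2 V)) :
    edgeBoundary (symmDiff s t) = edgeBoundary s + edgeBoundary t := by
  funext v
  exact Finset.sum_symmDiff_of_add_self _ (fun _ => CharTwo.add_self_eq_zero _) s t

@[simp]
lemma edgeBoundary_empty : edgeBoundary (∅ : Finset (Sym2 V)) = 0 := rfl

lemma edgeBoundary_singleton {u v : V} (h : u ≠ v) :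
    edgeBoundary {s(u, v)} = Pi.single u 1 + Pi.single v 1 := by
  funext x
  simp only [edgeBoundary, Finset.sum_singleton, Sym2.mem_iff, Pi.add_apply, Pi.single_apply]
  by_cases h1 : x = u <;> by_cases h2 : x = v <;> simp_all

lemma edgeBoundary_insert {s : Finset (Sym2 V)} {u v : V} (h : u ≠ v) (hs : s(u, v) ∉ s) :
    edgeBoundary (insert s(u, v) s) = Pi.single u 1 + Pi.single v 1 + edgeBoundary s := by
  rw [← edgeBoundary_singleton h, ← edgeBoundary_symmDiff]
  congr 1
  ext x
  simp only [Finset.mem_insert, Finset.mem_symmDiff, Finset.mem_singleton]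
  grind

lemma edgeBoundary_congr {s t : Finset (Sym2 V)} {v : V} (h : ∀ e, v ∈ e → (e ∈ s ↔ e ∈ t)) :
    edgeBoundary s v = edgeBoundary t v := by
  unfold edgeBoundary
  rw [← Finset.sum_filter, ← Finset.sum_filter]
  congr 1
  ext x
  simp only [Finset.mem_filter]
  grind

lemma exists_mem_of_edgeBoundary_ne_zero {s : Finset (Sym2 V)} {v : V}
    (h : edgeBoundary s v ≠ 0) : ∃ e ∈ s, v ∈ e := by
  contrapose! h
  exact Finset.sum_eq_zero fun e he => if_neg (h e he)

lemma edgeBoundary_edges {G : SimpleGraph V} {u v : V} {p : G.Walk u v} (hp : p.IsTrail) :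
    edgeBoundary p.edges.toFinset = Pi.single u 1 + Pi.single v 1 := by
  induction p with
  | nil => rw [ZMod.pi_add_self]; rfl
  | @cons u v w h p ih =>
    rw [Walk.isTrail_cons] at hp
    rw [Walk.edges_cons, List.toFinset_cons, edgeBoundary_insert h.ne (by simpa using hp.2),
      ih hp.1]
    have := ZMod.pi_add_self (Pi.single v 1 : V → ZMod 2)
    rw [add_add_add_comm, add_assoc, ← add_assoc (Pi.single v 1), this, zero_add]

lemma edgeBoundary_eq_zero_of_isCircleOf {G : SimpleGraph V} {s : Finset (Sym2 V)}
    (h : IsCircleOf G s) : edgeBoundary s = 0 := by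
  obtain ⟨a, w, hw, rfl⟩ := h
  rw [edgeBoundary_edges hw.isTrail, ZMod.pi_add_self]

lemma single_add_single_ne_zero {x y : V} (h : x ≠ y) :
    (Pi.single x 1 + Pi.single y 1 : V → ZMod 2) ≠ 0 := by
  intro h0
  have := congrFun h0 x
  simp [h] at this

lemma reachable_of_edgeBoundary_eq (s : Finset (Sym2 V)) (hs : ∀ e ∈ s, ¬ e.IsDiag) {u v : V}
    (h : edgeBoundary s = Pi.single u 1 + Pi.single v 1) :
    (fromEdgeSet (s : Set (Sym2 V))).Reachable u v := by
  induction hn : s.card generalizing s u with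
  | zero =>
    by_cases huv : u = v
    · exact huv ▸ Reachable.refl _
    · rw [Finset.card_eq_zero] at hn
      subst hn
      exact absurd h.symm (single_add_single_ne_zero huv)
  | succ n ih =>
    by_cases huv : u = v
    · exact huv ▸ Reachable.refl _
    obtain ⟨e, he, hue⟩ := exists_mem_of_edgeBoundary_ne_zero (s := s) (v := u)
      (by rw [h]; simp [huv])
    obtain ⟨x, rfl⟩ := Sym2.mem_iff_exists.1 hue
    have hux : u ≠ x := by simpa using hs _ he
    have hadj : (fromEdgeSet (s : Set (Sym2 V))).Adj u x := by simp [he, hux]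
    refine hadj.reachable.trans (Reachable.mono (fromEdgeSet_mono ?_)
      (ih (s.erase s(u, x)) (fun e he => hs e (Finset.mem_of_mem_erase he)) ?_ ?_))
    · exact_mod_cast Finset.erase_subset _ _
    · have h1 := edgeBoundary_insert hux (Finset.notMem_erase s(u, x) s)
      rw [Finset.insert_erase he, h] at h1
      have h3 := ZMod.pi_add_self (Pi.single x 1 : V → ZMod 2)
      linear_combination -h1 - h3
    · rw [Finset.card_erase_of_mem he, hn]; rfl

/-- Every edge of an edge set with all degrees even lies in a circle contained in that set. -/
lemma exists_isCircleOf_of_edgeBoundary_eq_zero {G : SimpleGraph V} {s : Finset (Sym2 V)}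
    (hs : ∀ e ∈ s, e ∈ G.edgeSet) (h : edgeBoundary s = 0) {g : Sym2 V} (hg : g ∈ s) :
    ∃ t, IsCircleOf G t ∧ g ∈ t ∧ t ⊆ s := by
  induction g with | _ u v
  have huv : G.Adj u v := hs _ hg
  have hb : edgeBoundary (s.erase s(u, v)) = Pi.single v 1 + Pi.single u 1 := by
    have h1 := edgeBoundary_insert huv.ne (Finset.notMem_erase s(u, v) s)
    rw [Finset.insert_erase hg, h] at h1
    have h2 := ZMod.pi_add_self (Pi.single u 1 + Pi.single v 1 : V → ZMod 2)
    linear_combination -h1 - h2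
  obtain ⟨p⟩ := reachable_of_edgeBoundary_eq (s.erase s(u, v))
    (fun e he => G.not_isDiag_of_mem_edgeSet (hs e (Finset.mem_of_mem_erase he))) hb
  have hsub : ∀ e ∈ p.bypass.edges, e ∈ s.erase s(u, v) := fun e he => by
    have := p.bypass.edges_subset_edgeSet he
    rw [edgeSet_fromEdgeSet] at this
    exact_mod_cast this.1
  have hG : ∀ e ∈ p.bypass.edges, e ∈ G.edgeSet := fun e he =>
    hs e (Finset.mem_of_mem_erase (hsub e he))
  refine ⟨_, ⟨u, Walk.cons huv (p.bypass.transfer G hG), ?_, rfl⟩, by simp, ?_⟩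
  · rw [Walk.cons_isCycle_iff, Walk.edges_transfer]
    exact ⟨p.bypass_isPath.transfer hG, fun h => Finset.notMem_erase _ _ (hsub _ h)⟩
  · intro e he
    simp only [Walk.edges_cons, Walk.edges_transfer, List.toFinset_cons, Finset.mem_insert,
      List.mem_toFinset] at he
    rcases he with rfl | he
    · exact hg
    · exact Finset.mem_of_mem_erase (hsub e he)

lemma eq_empty_of_subset_path {G : SimpleGraph V} {u v : V} {p : G.Walk u v} (hp : p.IsPath)
    {s : Finset (Sym2 V)} (hs : s ⊆ p.edges.toFinset) (h : ∀ x, x ≠ v → edgeBoundary s x = 0) :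
    s = ∅ := by
  induction p with
  | nil => simpa using hs
  | @cons u v w huv p ih =>
    rw [Walk.cons_isPath_iff] at hp
    have hu : ∀ e ∈ p.edges, u ∉ e := fun e he hue => hp.2 (p.mem_support_of_mem_edges he hue)
    have huw : u ≠ w := fun h => hp.2 (h ▸ p.end_mem_support)
    rw [Walk.edges_cons, List.toFinset_cons] at hs
    have hns : s(u, v) ∉ s := by
      intro hmem
      have h1 : edgeBoundary s u = edgeBoundary {s(u, v)} u := edgeBoundary_congr fun e hue => by
        rw [Finset.mem_singleton]
        refine ⟨fun he => ?_, fun he => he ▸ hmem⟩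
        rcases Finset.mem_insert.1 (hs he) with rfl | he
        · rfl
        · exact absurd hue (hu e (by simpa using he))
      rw [h u huw, edgeBoundary_singleton huv.ne] at h1
      simp [huv.ne] at h1
    exact ih hp.1 ((Finset.subset_insert_iff_of_notMem hns).1 hs) h

lemma eq_empty_or_eq_of_subset_path {G : SimpleGraph V} {u v : V} {p : G.Walk u v}
    (hp : p.IsPath) {s : Finset (Sym2 V)} (hs : s ⊆ p.edges.toFinset)
    (h : ∀ x, x ≠ u → x ≠ v → edgeBoundary s x = 0) : s = ∅ ∨ s = p.edges.toFinset := by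
  by_cases hu : edgeBoundary s u = 0
  · exact Or.inl (eq_empty_of_subset_path hp hs fun x hx =>
      (eq_or_ne x u).elim (fun h => h ▸ hu) fun hxu => h x hxu hx)
  · right
    have hb := edgeBoundary_edges hp.isTrail
    have h1 : edgeBoundary s u = 1 := by
      generalize edgeBoundary s u = z at hu
      revert z; decide
    rw [← symmDiff_eq_bot]
    refine eq_empty_of_subset_path hp (symmDiff_le_sup.trans (sup_le hs le_rfl)) fun x hx => ?_
    rw [edgeBoundary_symmDiff, hb]
    by_cases hxu : x = u
    · subst hxu
      simp [h1, hx, CharTwo.add_self_eq_zero]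
    · simp [h x hxu hx, hxu, hx]

lemma eq_empty_or_eq_of_subset_cycle {G : SimpleGraph V} {a : V} {w : G.Walk a a}
    (hw : w.IsCycle) {s : Finset (Sym2 V)} (hs : s ⊆ w.edges.toFinset)
    (h : edgeBoundary s = 0) : s = ∅ ∨ s = w.edges.toFinset := by
  cases w with
  | nil => simp at hw
  | @cons _ v _ huv p =>
    rw [Walk.cons_isCycle_iff] at hw
    rw [Walk.edges_cons, List.toFinset_cons] at hs ⊢
    by_cases hg : s(a, v) ∈ s
    · right
      have h1 := edgeBoundary_insert huv.ne (Finset.notMem_erase s(a, v) s)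
      rw [Finset.insert_erase hg, h] at h1
      have h2 : ∀ x, x ≠ v → x ≠ a → edgeBoundary (s.erase s(a, v)) x = 0 := fun x hx hx' => by
        simpa [hx, hx'] using (congrFun h1 x).symm
      rcases eq_empty_or_eq_of_subset_path hw.1 (Finset.subset_insert_iff.1 hs) h2 with h3 | h3
      · rw [h3, edgeBoundary_empty, add_zero] at h1
        exact absurd h1.symm (single_add_single_ne_zero huv.ne)
      · rw [← h3, Finset.insert_erase hg]
    · exact Or.inl (eq_empty_of_subset_path hw.1
        ((Finset.subset_insert_iff_of_notMem hg).1 hs) fun x _ => congrFun h x)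

lemma exists_arc {G : SimpleGraph V} {a : V} {w : G.Walk a a}
    (hw : w.IsCycle) {x y : V} (hx : x ∈ w.support) (hy : y ∈ w.support) :
    ∃ A ⊆ w.edges.toFinset, edgeBoundary A = Pi.single x 1 + Pi.single y 1 := by
  refine ⟨symmDiff (w.takeUntil x hx).edges.toFinset (w.takeUntil y hy).edges.toFinset,
    symmDiff_le_sup.trans (sup_le ?_ ?_), ?_⟩
  · exact fun e he => by simpa using w.edges_takeUntil_subset_edges hx (by simpa using he)
  · exact fun e he => by simpa using w.edges_takeUntil_subset_edges hy (by simpa using he)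
  · rw [edgeBoundary_symmDiff, edgeBoundary_edges (hw.isTrail.takeUntil hx),
      edgeBoundary_edges (hw.isTrail.takeUntil hy), add_add_add_comm, ZMod.pi_add_self,
      zero_add]

end CycleSpace

section Ears

variable {G : SimpleGraph V} {S : Set V}

/-- A path joining two distinct vertices of `S` which is internally disjoint from `S`. -/
structure IsEar (S : Set V) {x y : V} (R : G.Walk x y) : Prop where
  isPath : R.IsPath
  ne : x ≠ y
  left : x ∈ S
  right : y ∈ S
  interior : ∀ z ∈ R.support, z ∈ S → z = x ∨ z = y

/-- A pair of paths from a vertex `z` outside `S` to `S`, disjoint except at `z`. -/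
structure IsFan (S : Set V) {z x y : V} (p : G.Walk z x) (q : G.Walk z y) : Prop where
  notMem : z ∉ S
  left_isPath : p.IsPath
  right_isPath : q.IsPath
  inter : ∀ t ∈ p.support, t ∈ q.support → t = z
  left : x ∈ S
  right : y ∈ S
  left_interior : ∀ t ∈ p.support, t ∈ S → t = x
  right_interior : ∀ t ∈ q.support, t ∈ S → t = y

lemma IsFan.symm {z x y : V} {p : G.Walk z x} {q : G.Walk z y} (h : IsFan S p q) :
    IsFan S q p :=
  ⟨h.notMem, h.right_isPath, h.left_isPath, fun t hq hp => h.inter t hp hq, h.right, h.left,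
    h.right_interior, h.left_interior⟩

lemma isPath_append_of_inter {u v x : V} {p : G.Walk u v} {q : G.Walk v x} (hp : p.IsPath)
    (hq : q.IsPath) (h : ∀ t ∈ p.support, t ∈ q.support → t = v) : (p.append q).IsPath := by
  rw [Walk.isPath_def, Walk.support_append, List.nodup_append']
  refine ⟨hp.support_nodup, hq.support_nodup.tail, fun t ht ht' => ?_⟩
  obtain rfl := h t ht (List.mem_of_mem_tail ht')
  have := hq.support_nodup
  rw [← Walk.cons_tail_support, List.nodup_cons] at this
  exact this.1 ht'

lemma eq_of_mem_support_of_isPath_append {u v x t : V} {p : G.Walk u v} {q : G.Walk v x}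
    (h : (p.append q).IsPath) (hp : t ∈ p.support) (hq : t ∈ q.support) : t = v := by
  by_contra hne
  exact h.ne_of_mem_support_of_append hne hp hq rfl

lemma IsFan.isEar {z x y : V} {p : G.Walk z x} {q : G.Walk z y} (h : IsFan S p q) :
    IsEar S (p.reverse.append q) where
  isPath := isPath_append_of_inter h.left_isPath.reverse h.right_isPath fun t ht =>
    h.inter t (by simpa using ht)
  ne := by
    rintro rfl
    exact h.notMem (h.inter x p.end_mem_support q.end_mem_support ▸ h.left)
  left := h.left
  right := h.right
  interior t ht hS := by
    rw [Walk.mem_support_append_iff, Walk.support_reverse, List.mem_reverse] at ht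
    exact ht.imp (fun h1 => h.left_interior t h1 hS) fun h1 => h.right_interior t h1 hS

lemma IsEar.exists_isFan {x y z : V} {R : G.Walk x y} (h : IsEar S R) (hz : z ∈ R.support)
    (hzS : z ∉ S) : ∃ (p : G.Walk z x) (q : G.Walk z y), IsFan S p q ∧ R = p.reverse.append q := by
  obtain ⟨p, q, rfl⟩ := Walk.mem_support_iff_exists_append.1 hz
  have hi := fun t (h1 : t ∈ p.support) (h2 : t ∈ q.support) =>
    eq_of_mem_support_of_isPath_append h.isPath h1 h2
  refine ⟨p.reverse, q, ⟨hzS, h.isPath.of_append_left.reverse, h.isPath.of_append_right, ?_,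
    h.left, h.right, ?_, ?_⟩, by rw [Walk.reverse_reverse]⟩
  · exact fun t h1 h2 => hi t (by simpa using h1) h2
  · intro t h1 h2
    rw [Walk.support_reverse, List.mem_reverse] at h1
    refine (h.interior t (by simp [h1]) h2).resolve_right ?_
    rintro rfl
    exact hzS (hi t h1 q.end_mem_support ▸ h2)
  · intro t h1 h2
    refine (h.interior t (by simp [h1]) h2).resolve_left ?_
    rintro rfl
    exact hzS (hi t p.start_mem_support h1 ▸ h2)

lemma exists_isPath_to_first_mem {u v : V} {T : Set V} {p : G.Walk u v} (hp : p.IsPath)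
    (hv : v ∈ T) : ∃ (t : V) (q : G.Walk u t), q.IsPath ∧ t ∈ T ∧
      (∀ r ∈ q.support, r ∈ T → r = t) ∧ q.support ⊆ p.support := by
  induction p with
  | nil => exact ⟨_, Walk.nil, hp, hv, by simp, by simp⟩
  | @cons u x v h p ih =>
    by_cases hu : u ∈ T
    · exact ⟨u, Walk.nil, Walk.IsPath.nil, hu, by simp, by simp⟩
    · rw [Walk.cons_isPath_iff] at hp
      obtain ⟨t, q, hq, ht, hT, hs⟩ := ih hp.1 hv
      refine ⟨t, Walk.cons h q, hq.cons fun hu => hp.2 (hs hu), ht, ?_, ?_⟩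
      · intro r hr hrT
        rw [Walk.support_cons, List.mem_cons] at hr
        rcases hr with rfl | hr
        · exact absurd hrT hu
        · exact hT r hr hrT
      · rw [Walk.support_cons, Walk.support_cons]
        exact List.cons_subset_cons _ hs

lemma IsBlock.exists_isPath_avoiding (hG : IsBlock G) {u a b : V} (ha : a ≠ u) (hb : b ≠ u) :
    ∃ p : G.Walk a b, p.IsPath ∧ u ∉ p.support := by
  obtain ⟨p⟩ := (hG.2 u).preconnected ⟨a, by simpa using ha⟩ ⟨b, by simpa using hb⟩
  refine ⟨(p.map (Subgraph.hom _)).bypass, Walk.bypass_isPath _, fun h => ?_⟩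
  have h1 : u ∈ p.support.map (Subgraph.hom _) := by
    rw [← Walk.support_map]
    exact Walk.support_bypass_subset_support _ h
  obtain ⟨⟨c, hc⟩, -, h2⟩ := List.mem_map.1 h1
  exact hc.2 h2

/-- In a block, an edge at `z` extends to a path that meets a set `T` not contained in `{z}`
only at its end and possibly at `z`. -/
lemma IsBlock.exists_isPath_through (hG : IsBlock G) {z s w : V} {T : Set V} (hzw : G.Adj z w)
    (hs : s ∈ T) (hsz : s ≠ z) : ∃ (t : V) (q : G.Walk z t), q.IsPath ∧ s(z, w) ∈ q.edges ∧
      t ∈ T ∧ t ≠ z ∧ ∀ r ∈ q.support, r ∈ T → r = z ∨ r = t := by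
  obtain ⟨p, hp, hzp⟩ := hG.exists_isPath_avoiding hzw.ne' hsz
  obtain ⟨t, q, hq, ht, hT, hsub⟩ := exists_isPath_to_first_mem hp hs
  have hz : z ∉ q.support := fun h => hzp (hsub h)
  refine ⟨t, Walk.cons hzw q, hq.cons hz, by simp, ht, ?_, ?_⟩
  · rintro rfl
    exact hz q.end_mem_support
  · intro r hr hrT
    rw [Walk.support_cons, List.mem_cons] at hr
    exact hr.imp_right fun h => hT r h hrT

lemma IsBlock.exists_isEar_of_mem (hG : IsBlock G) (hS : S.Nontrivial) {u w : V} (hu : u ∈ S)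
    (huw : G.Adj u w) : ∃ (x y : V) (R : G.Walk x y), IsEar S R ∧ s(u, w) ∈ R.edges := by
  obtain ⟨s, hs, hsu⟩ := hS.exists_ne u
  obtain ⟨t, q, hq, he, ht, htu, hT⟩ := hG.exists_isPath_through huw hs hsu
  exact ⟨u, t, q, ⟨hq, htu.symm, hu, ht, hT⟩, he⟩

/-- Replace the initial part of the second path of a fan. -/
lemma IsFan.append_dropUntil {z x y t : V} {p : G.Walk z x} {q₁ : G.Walk z t} {q₂ : G.Walk t y}
    {q : G.Walk z t} (h : IsFan S p (q₁.append q₂)) (hq : q.IsPath) (htz : t ≠ z)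
    (hT : ∀ r ∈ q.support, r ∈ S ∨ r ∈ p.support ∨ r ∈ (q₁.append q₂).support → r = z ∨ r = t) :
    IsFan S p (q.append q₂) where
  notMem := h.notMem
  left_isPath := h.left_isPath
  right_isPath := by
    refine isPath_append_of_inter hq h.right_isPath.of_append_right fun r hr hr2 => ?_
    refine (hT r hr (Or.inr (Or.inr (by simp [hr2])))).resolve_left ?_
    rintro rfl
    exact htz.symm (eq_of_mem_support_of_isPath_append h.right_isPath q₁.start_mem_support hr2)
  inter r hp hr := by
    rw [Walk.mem_support_append_iff] at hr
    rcases hr with hr | hr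
    · refine (hT r hr (Or.inr (Or.inl hp))).elim id ?_
      rintro rfl
      exact h.inter r hp (by simp)
    · exact h.inter r hp (by simp [hr])
  left := h.left
  right := h.right
  left_interior := h.left_interior
  right_interior r hr hrS := by
    rw [Walk.mem_support_append_iff] at hr
    rcases hr with hr | hr
    · rcases hT r hr (Or.inl hrS) with rfl | rfl
      · exact absurd hrS h.notMem
      · exact h.right_interior r (by simp) hrS
    · exact h.right_interior r (by simp [hr]) hrS

/-- Replace the second path of a fan. -/
lemma IsFan.replace_right {z x y t : V} {p : G.Walk z x} {q' : G.Walk z y} {q : G.Walk z t}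
    (h : IsFan S p q') (hq : q.IsPath) (ht : t ∈ S) (htp : t ∉ p.support)
    (hT : ∀ r ∈ q.support, r ∈ S ∨ r ∈ p.support ∨ r ∈ q'.support → r = z ∨ r = t) :
    IsFan S p q where
  notMem := h.notMem
  left_isPath := h.left_isPath
  right_isPath := hq
  inter r hp hr := (hT r hr (Or.inr (Or.inl hp))).resolve_right fun h1 => htp (h1 ▸ hp)
  left := h.left
  right := ht
  left_interior := h.left_interior
  right_interior r hr hrS :=
    (hT r hr (Or.inl hrS)).resolve_left fun h1 => h.notMem (h1 ▸ hrS)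

lemma IsBlock.exists_isEar_of_isFan (hG : IsBlock G) {x y z w : V} {p : G.Walk z x}
    {q : G.Walk z y} (h : IsFan S p q) (hzw : G.Adj z w) :
    ∃ (x y : V) (R : G.Walk x y), IsEar S R ∧ s(z, w) ∈ R.edges := by
  obtain ⟨t, r, hr, he, ht, htz, hT⟩ := hG.exists_isPath_through
    (T := {r | r ∈ S ∨ r ∈ p.support ∨ r ∈ q.support}) hzw (Or.inl h.left)
    (fun h1 => h.notMem (h1 ▸ h.left))
  by_cases htq : t ∈ q.support
  · obtain ⟨q₁, q₂, rfl⟩ := Walk.mem_support_iff_exists_append.1 htq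
    exact ⟨_, _, _, (h.append_dropUntil hr htz hT).isEar, by simp [he]⟩
  by_cases htp : t ∈ p.support
  · obtain ⟨p₁, p₂, rfl⟩ := Walk.mem_support_iff_exists_append.1 htp
    exact ⟨_, _, _, (h.symm.append_dropUntil hr htz
      fun a ha hc => hT a ha (hc.imp_right Or.symm)).isEar, by simp [he]⟩
  · exact ⟨_, _, _, (h.replace_right hr (ht.resolve_right (by tauto)) htp hT).isEar, by simp [he]⟩

/-- In a block, every edge lies in an ear of a set with at least two vertices. -/
lemma IsBlock.exists_isEar (hG : IsBlock G) (hS : S.Nontrivial) {g : Sym2 V} (hg : g ∈ G.edgeSet) :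
    ∃ (x y : V) (R : G.Walk x y), IsEar S R ∧ g ∈ R.edges := by
  induction g with | _ u w
  obtain ⟨s, hs⟩ := hS.nonempty
  obtain ⟨p⟩ := hG.1.preconnected u s
  have key : ∀ w, G.Adj u w → ∃ (x y : V) (R : G.Walk x y), IsEar S R ∧ s(u, w) ∈ R.edges := by
    clear hg w
    induction p with
    | nil => exact fun w hw => hG.exists_isEar_of_mem hS hs hw
    | @cons u v s h p ih =>
      intro w hw
      by_cases hu : u ∈ S
      · exact hG.exists_isEar_of_mem hS hu hw
      obtain ⟨x, y, R, hR, he⟩ := ih hs u h.symm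
      obtain ⟨p, q, hpq, -⟩ := hR.exists_isFan (R.snd_mem_support_of_mem_edges he) hu
      exact hG.exists_isEar_of_isFan hpq hw
  exact key w hg

end Ears

section Bridges

variable {G : SimpleGraph V} {S : Set V}

/-- An edge set containing, with an edge at a vertex outside `S`, all edges at that vertex. -/
def IsClosedOff (G : SimpleGraph V) (S : Set V) (F : Set (Sym2 V)) : Prop :=
  ∀ z ∉ S, ∀ g ∈ F, z ∈ g → ∀ g' ∈ G.edgeSet, z ∈ g' → g' ∈ F

lemma IsBridgeOf.subset_edgeSet {a : V} {w : G.Walk a a} {F : Set (Sym2 V)}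
    (hF : IsBridgeOf G w F) : F ⊆ G.edgeSet := by
  rcases hF with ⟨x, y, -, -, -, h, -, rfl⟩ | ⟨D, -, -, -, -, rfl⟩
  · rintro _ rfl
    exact h
  · exact fun _ h => h.1

lemma IsBridgeOf.notMem_edges {a : V} {w : G.Walk a a} {F : Set (Sym2 V)}
    (hF : IsBridgeOf G w F) {g : Sym2 V} (hg : g ∈ F) : g ∉ w.edges := by
  rcases hF with ⟨x, y, -, -, -, -, h, rfl⟩ | ⟨D, -, hD, -, -, rfl⟩
  · exact hg.symm ▸ h
  · obtain ⟨-, x, hx, hxg⟩ := hg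
    exact fun h => hD x hx (w.mem_support_of_mem_edges h hxg)

lemma IsBridgeOf.isClosedOff {a : V} {w : G.Walk a a} {F : Set (Sym2 V)}
    (hF : IsBridgeOf G w F) : IsClosedOff G {z | z ∈ w.support} F := by
  rcases hF with ⟨x, y, -, hx, hy, -, h, rfl⟩ | ⟨D, -, hD, -, hD', rfl⟩
  · rintro z hz _ rfl hzg
    rcases Sym2.mem_iff.1 hzg with rfl | rfl
    · exact absurd hx hz
    · exact absurd hy hz
  · rintro z hz g ⟨hg, d, hd, hdg⟩ hzg g' hg' hzg'
    refine ⟨hg', z, ?_, hzg'⟩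
    by_cases hdz : d = z
    · exact hdz ▸ hd
    · rw [(Sym2.mem_and_mem_iff hdz).1 ⟨hdg, hzg⟩] at hg
      exact (hD' d hd z hg).resolve_right hz

lemma IsBridgeOf.nonempty (hG : G.Connected) {a : V} {w : G.Walk a a} {F : Set (Sym2 V)}
    (hF : IsBridgeOf G w F) : F.Nonempty := by
  rcases hF with ⟨x, y, -, -, -, -, -, rfl⟩ | ⟨D, ⟨d, hd⟩, hD, -, -, rfl⟩
  · exact Set.singleton_nonempty _
  · obtain ⟨p⟩ := hG.preconnected d a
    cases p with
    | nil => exact absurd w.start_mem_support (hD _ hd)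
    | cons h _ => exact ⟨_, h, d, hd, Sym2.mem_mk_left _ _⟩

lemma IsBridgeOf.subset_of_isClosedOff {a : V} {w : G.Walk a a} {F F' : Set (Sym2 V)}
    (hF : IsBridgeOf G w F) (hF' : IsClosedOff G {z | z ∈ w.support} F') {g : Sym2 V}
    (hg : g ∈ F) (hg' : g ∈ F') : F ⊆ F' := by
  rcases hF with ⟨x, y, -, -, -, -, -, rfl⟩ | ⟨D, -, hD, hconn, -, rfl⟩
  · rintro _ rfl
    exact (Set.mem_singleton_iff.1 hg) ▸ hg'
  · rintro k ⟨hk, x, hx, hxk⟩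
    obtain ⟨-, d, hd, hdg⟩ := hg
    obtain ⟨p⟩ := hconn.preconnected ⟨d, hd⟩ ⟨x, hx⟩
    have key : ∀ {u v : D} (p : (G.induce D).Walk u v),
        (∀ k ∈ G.edgeSet, u.1 ∈ k → k ∈ F') → ∀ k ∈ G.edgeSet, v.1 ∈ k → k ∈ F' := by
      intro u v p
      induction p with
      | nil => exact fun h => h
      | @cons u x v h p ih =>
        have hadj : G.Adj u.1 x.1 := h
        exact fun hu => ih fun k hk hxk => hF' x.1 (hD x.1 x.2) s(u.1, x.1)
          (hu _ hadj (Sym2.mem_mk_left _ _)) (Sym2.mem_mk_right _ _) k hk hxk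
    exact key p (fun k hk hdk => hF' d (hD d hd) g hg' hdg k hk hdk) k hk hxk

lemma IsBridgeOf.eq_of_mem {a : V} {w : G.Walk a a} {F F' : Set (Sym2 V)}
    (hF : IsBridgeOf G w F) (hF' : IsBridgeOf G w F') {g : Sym2 V}
    (hg : g ∈ F) (hg' : g ∈ F') : F = F' :=
  (hF.subset_of_isClosedOff hF'.isClosedOff hg hg').antisymm
    (hF'.subset_of_isClosedOff hF.isClosedOff hg' hg)

lemma exists_isBridgeOf {a : V} (w : G.Walk a a) {g : Sym2 V} (hg : g ∈ G.edgeSet)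
    (hgw : g ∉ w.edges) : ∃ F, IsBridgeOf G w F ∧ g ∈ F := by
  by_cases h : ∀ z ∈ g, z ∈ w.support
  · induction g with | _ u v
    exact ⟨{s(u, v)}, Or.inl ⟨u, v, G.ne_of_adj hg, h u (by simp), h v (by simp), hg, hgw, rfl⟩,
      rfl⟩
  push Not at h
  obtain ⟨u, hug, hu⟩ := h
  let D : Set V := {v | ∃ p : G.Walk u v, ∀ z ∈ p.support, z ∉ w.support}
  have huD : u ∈ D := ⟨Walk.nil, by simpa using hu⟩
  refine ⟨_, Or.inr ⟨D, ⟨u, huD⟩, ?_, ?_, ?_, rfl⟩, hg, u, huD, hug⟩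
  · rintro x ⟨p, hp⟩
    exact hp x p.end_mem_support
  · rw [connected_iff_exists_forall_reachable]
    refine ⟨⟨u, huD⟩, ?_⟩
    rintro ⟨v, p, hp⟩
    exact ⟨p.induce D fun z hz => ⟨p.takeUntil z hz, fun t ht =>
      hp t (p.support_takeUntil_subset_support hz ht)⟩⟩
  · rintro x ⟨p, hp⟩ y hxy
    by_cases hy : y ∈ w.support
    · exact Or.inr hy
    · left
      refine ⟨p.concat hxy, fun z hz => ?_⟩
      rw [Walk.support_concat, List.mem_append, List.mem_singleton] at hz
      rcases hz with hz | rfl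
      · exact hp z hz
      · exact hy

lemma IsClosedOff.edges_subset_of_isPath {F : Set (Sym2 V)} (hF : IsClosedOff G S F) {x y : V}
    {R : G.Walk x y} (hR : R.IsPath) (hS : ∀ z ∈ R.support, z ∈ S → z = x ∨ z = y) {g : Sym2 V}
    (hg : g ∈ R.edges) (hgF : g ∈ F) : ∀ e ∈ R.edges, e ∈ F := by
  induction R generalizing g with
  | nil => simp at hg
  | @cons u v y huv p ih =>
    rw [Walk.cons_isPath_iff] at hR
    have hS' : ∀ z ∈ p.support, z ∈ S → z = y := fun z hz hzS =>
      (hS z (by simp [hz]) hzS).resolve_left fun h => hR.2 (h ▸ hz)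
    have hp := fun {g} => ih hR.1 (g := g) fun z hz hzS => Or.inr (hS' z hz hzS)
    rw [Walk.edges_cons, List.mem_cons] at hg
    cases p with
    | nil =>
      rcases hg with rfl | hg
      · simpa using hgF
      · simp at hg
    | @cons _ x _ hvx p =>
      have hv : v ∉ S := fun h => by
        rw [Walk.cons_isPath_iff] at hR
        exact hR.1.2 (hS' v (by simp) h ▸ p.end_mem_support)
      intro e he
      rw [Walk.edges_cons, List.mem_cons] at he
      rcases hg with rfl | hg
      · rcases he with rfl | he
        · exact hgF
        · exact hp (g := s(v, x)) (by simp)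
            (hF v hv _ hgF (by simp) _ hvx (by simp)) e he
      · rcases he with rfl | he
        · exact hF v hv s(v, x) (hp hg hgF _ (by simp)) (by simp) _ huv (by simp)
        · exact hp hg hgF e he

lemma IsClosedOff.edges_subset {F : Set (Sym2 V)} (hF : IsClosedOff G S F) {x y : V}
    {R : G.Walk x y} (hR : IsEar S R) {g : Sym2 V}
    (hg : g ∈ R.edges) (hgF : g ∈ F) : ∀ e ∈ R.edges, e ∈ F :=
  hF.edges_subset_of_isPath hR.isPath hR.interior hg hgF

lemma eq_of_mem_edges_of_isPath {z y b c : V} {p : G.Walk z y} (hp : p.IsPath)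
    (hb : s(z, b) ∈ p.edges) (hc : s(z, c) ∈ p.edges) : b = c := by
  cases p with
  | nil => simp at hb
  | @cons _ x _ h p =>
    rw [Walk.cons_isPath_iff] at hp
    have key : ∀ d, s(z, d) ∈ (Walk.cons h p).edges → d = x := fun d hd => by
      rw [Walk.edges_cons, List.mem_cons] at hd
      exact hd.elim (fun h1 => Sym2.congr_right.1 h1)
        fun h1 => absurd (p.fst_mem_support_of_mem_edges h1) hp.2
    rw [key b hb, key c hc]

lemma eq_or_eq_of_mem_edges_of_isPath {x y z b c d : V} {p : G.Walk x y} (hp : p.IsPath)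
    (hb : s(z, b) ∈ p.edges) (hc : s(z, c) ∈ p.edges) (hbc : b ≠ c) (hd : s(z, d) ∈ p.edges) :
    d = b ∨ d = c := by
  obtain ⟨q, r, rfl⟩ := Walk.mem_support_iff_exists_append.1 (p.fst_mem_support_of_mem_edges hb)
  have hq := fun b c => eq_of_mem_edges_of_isPath (b := b) (c := c) hp.of_append_left.reverse
  have hr := fun b c => eq_of_mem_edges_of_isPath (b := b) (c := c) hp.of_append_right
  simp only [Walk.edges_reverse, List.mem_reverse] at hq
  simp only [Walk.edges_append, List.mem_append] at hb hc hd
  grind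

/-- A bridge which is a path is a single ear. -/
lemma IsBridgeOf.subset_edges_of_isPath {a : V} {w : G.Walk a a} {F : Set (Sym2 V)}
    (hF : IsBridgeOf G w F) {u v : V} {Q : G.Walk u v} (hQ : Q.IsPath)
    (hQF : ∀ g, g ∈ Q.edges ↔ g ∈ F) {x y : V} {R : G.Walk x y}
    (hR : IsEar {z | z ∈ w.support} R) {f : Sym2 V} (hf : f ∈ R.edges) (hfF : f ∈ F) :
    ∀ g ∈ F, g ∈ R.edges := by
  refine hF.subset_of_isClosedOff (F' := {g | g ∈ R.edges}) ?_ hfF hf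
  have hRF := hF.isClosedOff.edges_subset hR hf hfF
  intro z hz g hg hzg g' hg' hzg'
  obtain ⟨p, q, hpq, rfl⟩ := hR.exists_isFan (R.mem_support_of_mem_edges hg hzg) hz
  have hg'F : g' ∈ F := hF.isClosedOff z hz g (hRF g hg) hzg g' hg' hzg'
  cases p with
  | nil => exact absurd hpq.left hpq.notMem
  | @cons _ b _ hb p =>
    cases q with
    | nil => exact absurd hpq.right hpq.notMem
    | @cons _ c _ hc q =>
      have hbc : b ≠ c := fun h => hb.ne (hpq.inter b (by simp) (by simp [h])).symm
      obtain ⟨d, rfl⟩ := Sym2.mem_iff_exists.1 hzg'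
      rcases eq_or_eq_of_mem_edges_of_isPath hQ ((hQF s(z, b)).2 (hRF _ (by simp)))
        ((hQF s(z, c)).2 (hRF _ (by simp))) hbc ((hQF _).2 hg'F) with rfl | rfl
      · simp
      · simp

end Bridges

section Handles

variable {G : SimpleGraph V}

/-- An even edge set containing no edges that leave the path `R` at an interior vertex either
contains `R` or is disjoint from it. -/
lemma disjoint_or_edges_subset {x y : V} {R : G.Walk x y} (hR : R.IsPath) {Z : Finset (Sym2 V)}
    (hZ : edgeBoundary Z = 0)
    (h : ∀ z ∈ R.support, z ≠ x → z ≠ y → ∀ g ∈ Z, z ∈ g → g ∈ R.edges) :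
    Disjoint Z R.edges.toFinset ∨ R.edges.toFinset ⊆ Z := by
  have h0 : ∀ z, z ≠ x → z ≠ y → edgeBoundary (Z ∩ R.edges.toFinset) z = 0 := fun z hx hy => by
    by_contra h1
    obtain ⟨g, hg, hzg⟩ := exists_mem_of_edgeBoundary_ne_zero h1
    have hz := R.mem_support_of_mem_edges (by simpa using (Finset.mem_inter.1 hg).2) hzg
    refine h1 ((edgeBoundary_congr fun g hzg => ?_).trans (congrFun hZ z))
    rw [Finset.mem_inter, List.mem_toFinset]
    exact ⟨fun h2 => h2.1, fun h2 => ⟨h2, h z hz hx hy g h2 hzg⟩⟩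
  exact (eq_empty_or_eq_of_subset_path hR Finset.inter_subset_right h0).imp
    Finset.disjoint_iff_inter_eq_empty.2 Finset.inter_eq_right.1

lemma exists_symmDiff_subset {Z U R A : Finset (Sym2 V)} (hZ : edgeBoundary Z = 0)
    (hZU : Z ⊆ U ∪ R) (hA : A ⊆ U) (hAR : edgeBoundary A = edgeBoundary R)
    (hR : Disjoint Z R ∨ R ⊆ Z) : ∃ Y, (Y = ∅ ∨ Y = symmDiff R A) ∧ symmDiff Z Y ⊆ U ∧
      edgeBoundary (symmDiff Z Y) = 0 := by
  rcases hR with h | h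
  · refine ⟨∅, Or.inl rfl, fun g hg => ?_, by simp [edgeBoundary_symmDiff, hZ]⟩
    rw [Finset.disjoint_left] at h
    have := @hZU g
    have := @h g
    simp only [Finset.mem_symmDiff, Finset.mem_union] at *
    grind
  · refine ⟨_, Or.inr rfl, fun g hg => ?_, ?_⟩
    · have := @hZU g
      have := @h g
      have := @hA g
      simp only [Finset.mem_symmDiff, Finset.mem_union] at *
      grind
    · rw [edgeBoundary_symmDiff, edgeBoundary_symmDiff, hZ, hAR, ZMod.pi_add_self, add_zero]

/-- An ear of the support of a closed walk whose edges are not on the walk. -/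
structure IsHandle {a : V} (w : G.Walk a a) {x y : V} (R : G.Walk x y) : Prop extends
    IsEar {z | z ∈ w.support} R where
  notMem_edges : ∀ g ∈ R.edges, g ∉ w.edges

/-- Two handles of `w` which share no edges, and no vertices off `w`. -/
structure AreDisjointHandles {a : V} (w : G.Walk a a) {x₁ y₁ x₂ y₂ : V} (R₁ : G.Walk x₁ y₁)
    (R₂ : G.Walk x₂ y₂) : Prop where
  left : IsHandle w R₁
  right : IsHandle w R₂
  disjoint : ∀ g ∈ R₁.edges, g ∉ R₂.edges
  inter : ∀ z ∈ R₁.support, z ∈ R₂.support → z ∈ w.support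

/-- An edge `e` in the positive circle `C` and in no other positive circle. -/
structure IsPositiveBattery (G : SimpleGraph V) (σ : Sym2 V → ℤˣ) (C : Finset (Sym2 V))
    (e : Sym2 V) : Prop where
  mem : e ∈ C
  esign_eq : esign σ C = 1
  eq_of_mem : ∀ s, IsCircleOf G s → e ∈ s → esign σ s = 1 → s = C

variable {a : V} {w : G.Walk a a} {x y x₁ y₁ x₂ y₂ : V} {R : G.Walk x y} {R₁ : G.Walk x₁ y₁}
  {R₂ : G.Walk x₂ y₂} {σ : Sym2 V → ℤˣ} {e : Sym2 V}

lemma IsEar.edges_ne_nil {S : Set V} (h : IsEar S R) : R.edges ≠ [] := by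
  cases R with
  | nil => exact absurd rfl h.ne
  | cons => simp

lemma symmDiff_edges_eq (hw : w.IsCycle) {Z Y : Finset (Sym2 V)}
    (h : symmDiff Z Y ⊆ w.edges.toFinset) (h0 : edgeBoundary (symmDiff Z Y) = 0) :
    Z = Y ∨ Z = symmDiff Y w.edges.toFinset := by
  rcases eq_empty_or_eq_of_subset_cycle hw h h0 with h1 | h1
  · exact Or.inl (symmDiff_eq_bot.1 h1)
  · rw [← h1, symmDiff_comm Z, symmDiff_symmDiff_cancel_left]
    exact Or.inr rfl

lemma IsHandle.even_subset (hw : w.IsCycle) (hR : IsHandle w R) {Z A : Finset (Sym2 V)}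
    (hZ : edgeBoundary Z = 0) (hZR : Z ⊆ w.edges.toFinset ∪ R.edges.toFinset)
    (hA : A ⊆ w.edges.toFinset) (hAR : edgeBoundary A = edgeBoundary R.edges.toFinset) :
    ∃ Y, (Y = ∅ ∨ Y = symmDiff R.edges.toFinset A) ∧
      (Z = Y ∨ Z = symmDiff Y w.edges.toFinset) := by
  obtain ⟨Y, hY, h1, h2⟩ := exists_symmDiff_subset hZ hZR hA hAR <| by
    refine disjoint_or_edges_subset hR.isPath hZ fun z hz hx hy g hg hzg => ?_
    rcases Finset.mem_union.1 (hZR hg) with h | h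
    · exact ((hR.interior z hz (w.mem_support_of_mem_edges (by simpa using h) hzg)).elim hx hy).elim
    · simpa using h
  exact ⟨Y, hY, symmDiff_edges_eq hw h1 h2⟩

lemma AreDisjointHandles.even_subset (hw : w.IsCycle) (h : AreDisjointHandles w R₁ R₂)
    {Z A₁ A₂ : Finset (Sym2 V)} (hZ : edgeBoundary Z = 0)
    (hZR : Z ⊆ w.edges.toFinset ∪ R₁.edges.toFinset ∪ R₂.edges.toFinset)
    (hA₁ : A₁ ⊆ w.edges.toFinset) (hAR₁ : edgeBoundary A₁ = edgeBoundary R₁.edges.toFinset)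
    (hA₂ : A₂ ⊆ w.edges.toFinset) (hAR₂ : edgeBoundary A₂ = edgeBoundary R₂.edges.toFinset) :
    ∃ Y₁ Y₂, (Y₁ = ∅ ∨ Y₁ = symmDiff R₁.edges.toFinset A₁) ∧
      (Y₂ = ∅ ∨ Y₂ = symmDiff R₂.edges.toFinset A₂) ∧
      (Z = symmDiff Y₁ Y₂ ∨ Z = symmDiff (symmDiff Y₁ Y₂) w.edges.toFinset) := by
  obtain ⟨Y₂, hY₂, h1, h2⟩ := exists_symmDiff_subset hZ hZR
    (hA₂.trans Finset.subset_union_left) hAR₂ <| by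
    refine disjoint_or_edges_subset h.right.isPath hZ fun z hz hx hy g hg hzg => ?_
    have hzw : z ∉ w.support := fun hzw => (h.right.interior z hz hzw).elim hx hy
    have := hZR hg
    simp only [Finset.mem_union, List.mem_toFinset] at this
    rcases this with (h3 | h3) | h3
    · exact (hzw (w.mem_support_of_mem_edges h3 hzg)).elim
    · exact (hzw (h.inter z (R₁.mem_support_of_mem_edges h3 hzg) hz)).elim
    · exact h3
  obtain ⟨Y₁, hY₁, h4⟩ := h.left.even_subset hw h2 h1 hA₁ hAR₁
  refine ⟨Y₁, Y₂, hY₁, hY₂, ?_⟩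
  have h5 : Z = symmDiff (symmDiff Z Y₂) Y₂ := (symmDiff_symmDiff_cancel_right _ _).symm
  rcases h4 with h4 | h4
  · exact Or.inl (by rw [← h4, ← h5])
  · exact Or.inr (by rw [symmDiff_right_comm, ← h4, ← h5])

/-- There is an arc of the circle with the same ends as a given handle, not containing `e`. -/
lemma IsHandle.exists_arc (hw : w.IsCycle) (hR : IsHandle w R) (e : Sym2 V) :
    ∃ A ⊆ w.edges.toFinset, edgeBoundary A = edgeBoundary R.edges.toFinset ∧ e ∉ A := by
  obtain ⟨A, hA, h⟩ := _root_.exists_arc hw hR.left hR.right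
  rw [← edgeBoundary_edges hR.isPath.isTrail] at h
  by_cases he : e ∈ A
  · refine ⟨symmDiff A w.edges.toFinset, fun g hg => ?_, ?_, fun h1 => ?_⟩
    · have := @hA g
      simp only [Finset.mem_symmDiff] at hg
      tauto
    · rw [edgeBoundary_symmDiff, h, edgeBoundary_edges hw.isTrail, ZMod.pi_add_self, add_zero]
    · have := hA he
      simp only [Finset.mem_symmDiff] at h1
      tauto
  · exact ⟨A, hA, h, he⟩

lemma IsHandle.boundary_ne_zero (hR : IsHandle w R) : edgeBoundary R.edges.toFinset ≠ 0 := by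
  rw [edgeBoundary_edges hR.isPath.isTrail]
  exact single_add_single_ne_zero hR.ne

lemma mem_edgeSet_of_mem_edges_union (w : G.Walk a a) (R : G.Walk x y) :
    ∀ g ∈ w.edges.toFinset ∪ R.edges.toFinset, g ∈ G.edgeSet := by
  intro g hg
  simp only [Finset.mem_union, List.mem_toFinset] at hg
  exact hg.elim (w.edges_subset_edgeSet ·) (R.edges_subset_edgeSet ·)

/-- Every path through a bridge forms a negative circle with either arc of the circle. -/
lemma IsHandle.esign_mul (hw : w.IsCycle) (he : IsPositiveBattery G σ w.edges.toFinset e)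
    (hR : IsHandle w R) {A : Finset (Sym2 V)} (hA : A ⊆ w.edges.toFinset)
    (hAR : edgeBoundary A = edgeBoundary R.edges.toFinset) :
    esign σ R.edges.toFinset * esign σ A = -1 := by
  have key : ∀ A ⊆ w.edges.toFinset, edgeBoundary A = edgeBoundary R.edges.toFinset → e ∈ A →
      esign σ R.edges.toFinset * esign σ A = -1 := by
    clear! A
    intro A hA hAR heA
    have hd : ∀ g ∈ R.edges.toFinset, g ∉ w.edges.toFinset := by simpa using hR.notMem_edges
    have heR : e ∉ R.edges.toFinset := fun h => hd e h he.mem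
    have h0 : edgeBoundary (symmDiff R.edges.toFinset A) = 0 := by
      rw [edgeBoundary_symmDiff, hAR, ZMod.pi_add_self]
    have hsub : symmDiff R.edges.toFinset A ⊆ w.edges.toFinset ∪ R.edges.toFinset := by
      intro g hg
      have := @hA g
      simp only [Finset.mem_symmDiff, Finset.mem_union] at hg ⊢
      tauto
    obtain ⟨K, hK, heK, hKs⟩ := exists_isCircleOf_of_edgeBoundary_eq_zero
      (fun g hg => mem_edgeSet_of_mem_edges_union w R g (hsub hg)) h0
      (Finset.mem_symmDiff.2 (Or.inr ⟨heA, heR⟩))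
    have hK0 := edgeBoundary_eq_zero_of_isCircleOf hK
    obtain ⟨Y, rfl | rfl, rfl | rfl⟩ := hR.even_subset hw hK0 (hKs.trans hsub) hA hAR
    · simp at heK
    · exfalso
      refine hR.boundary_ne_zero ?_
      rw [← hAR, ← edgeBoundary_eq_zero_of_isCircleOf hK]
      congr 1
      ext g
      have := @hKs g
      have := @hA g
      have := hd g
      simp only [Finset.mem_symmDiff, Finset.notMem_empty] at *
      tauto
    · rw [← esign_symmDiff]
      refine (Int.units_eq_one_or _).resolve_left fun h1 => ?_
      obtain ⟨g, hg⟩ := List.exists_mem_of_ne_nil _ hR.edges_ne_nil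
      have h2 := he.eq_of_mem _ hK heK h1
      rw [Finset.ext_iff] at h2
      have := h2 g
      have := hd g
      have := @hA g
      simp only [Finset.mem_symmDiff] at *
      have := List.mem_toFinset.2 hg
      tauto
    · exfalso
      have := he.mem
      simp only [Finset.mem_symmDiff] at heK
      tauto
  by_cases heA : e ∈ A
  · exact key A hA hAR heA
  · have h := key (symmDiff A w.edges.toFinset) (fun g hg => ?_) ?_ ?_
    · rwa [esign_symmDiff, he.esign_eq, mul_one] at h
    · have := @hA g
      simp only [Finset.mem_symmDiff] at hg
      tauto
    · rw [edgeBoundary_symmDiff, edgeBoundary_edges hw.isTrail, ZMod.pi_add_self, hAR, add_zero]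
    · exact Finset.mem_symmDiff.2 (Or.inr ⟨he.mem, heA⟩)

/-- Two disjoint handles form, with the circle, a unique positive circle through their edges. -/
lemma AreDisjointHandles.exists_isCircleOf (hw : w.IsCycle)
    (he : IsPositiveBattery G σ w.edges.toFinset e) (h : AreDisjointHandles w R₁ R₂) :
    ∃ H, IsCircleOf G H ∧ esign σ H = 1 ∧ R₁.edges.toFinset ⊆ H ∧ R₂.edges.toFinset ⊆ H ∧
      H ⊆ w.edges.toFinset ∪ R₁.edges.toFinset ∪ R₂.edges.toFinset ∧
      ∀ t, IsCircleOf G t → esign σ t = 1 →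
        t ⊆ w.edges.toFinset ∪ R₁.edges.toFinset ∪ R₂.edges.toFinset →
        (∃ g ∈ t, g ∈ R₁.edges) → t = H := by
  obtain ⟨A₁, hA₁, hAR₁, heA₁⟩ := h.left.exists_arc hw e
  obtain ⟨A₂, hA₂, hAR₂, heA₂⟩ := h.right.exists_arc hw e
  have hs₁ := h.left.esign_mul hw he hA₁ hAR₁
  have hs₂ := h.right.esign_mul hw he hA₂ hAR₂
  have hb₁ := h.left.boundary_ne_zero
  have hb₂ := h.right.boundary_ne_zero
  obtain ⟨r, hr⟩ := List.exists_mem_of_ne_nil _ h.left.edges_ne_nil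
  rw [← List.mem_toFinset] at hr
  have hU : ∀ g ∈ w.edges.toFinset ∪ R₁.edges.toFinset ∪ R₂.edges.toFinset, g ∈ G.edgeSet := by
    intro g hg
    rcases Finset.mem_union.1 hg with hg | hg
    · exact mem_edgeSet_of_mem_edges_union w R₁ g hg
    · exact mem_edgeSet_of_mem_edges_union w R₂ g (Finset.mem_union_right _ hg)
  have hd₁ : ∀ g ∈ R₁.edges.toFinset, g ∉ w.edges.toFinset := by simpa using h.left.notMem_edges
  have hd₂ : ∀ g ∈ R₂.edges.toFinset, g ∉ w.edges.toFinset := by simpa using h.right.notMem_edges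
  have hd : ∀ g ∈ R₁.edges.toFinset, g ∉ R₂.edges.toFinset := by simpa using h.disjoint
  have hspan := fun Z hZ hZR => h.even_subset hw (Z := Z) hZ hZR hA₁ hAR₁ hA₂ hAR₂
  have heC := he.mem
  have hCs := he.esign_eq
  have hCu := he.eq_of_mem
  have hC0 : edgeBoundary w.edges.toFinset = 0 := by
    rw [edgeBoundary_edges hw.isTrail, ZMod.pi_add_self]
  have hne₁ : A₁.Nonempty := by
    rw [Finset.nonempty_iff_ne_empty]
    rintro rfl
    exact hb₁ hAR₁.symm
  have hne₂ : A₂.Nonempty := by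
    rw [Finset.nonempty_iff_ne_empty]
    rintro rfl
    exact hb₂ hAR₂.symm
  generalize w.edges.toFinset = C at *
  simp only [← List.mem_toFinset]
  generalize R₁.edges.toFinset = B₁ at *
  generalize R₂.edges.toFinset = B₂ at *
  have hs₁' : esign σ (symmDiff B₁ A₁) = -1 := by rw [esign_symmDiff, hs₁]
  have hs₂' : esign σ (symmDiff B₂ A₂) = -1 := by rw [esign_symmDiff, hs₂]
  have h0₁ : edgeBoundary (symmDiff B₁ A₁) = 0 := by
    rw [edgeBoundary_symmDiff, hAR₁, ZMod.pi_add_self]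
  have h0₂ : edgeBoundary (symmDiff B₂ A₂) = 0 := by
    rw [edgeBoundary_symmDiff, hAR₂, ZMod.pi_add_self]
  have hm₁ : ∀ g, g ∈ symmDiff B₁ A₁ ↔ g ∈ B₁ ∨ g ∈ A₁ := by
    intro g
    have := @hA₁ g
    have := hd₁ g
    rw [Finset.mem_symmDiff]
    tauto
  have hm₂ : ∀ g, g ∈ symmDiff B₂ A₂ ↔ g ∈ B₂ ∨ g ∈ A₂ := by
    intro g
    have := @hA₂ g
    have := hd₂ g
    rw [Finset.mem_symmDiff]
    tauto
  generalize symmDiff B₁ A₁ = Z₁ at *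
  generalize symmDiff B₂ A₂ = Z₂ at *
  have heB₁ : e ∉ B₁ := fun h => hd₁ e h heC
  have heB₂ : e ∉ B₂ := fun h => hd₂ e h heC
  have hHs : esign σ (symmDiff Z₁ Z₂) = 1 := by
    rw [esign_symmDiff, hs₁', hs₂']
    rfl
  have hH0 : edgeBoundary (symmDiff Z₁ Z₂) = 0 := by
    rw [edgeBoundary_symmDiff, h0₁, h0₂, add_zero]
  have hB₁H : B₁ ⊆ symmDiff Z₁ Z₂ := fun g hg => by
    rw [Finset.mem_symmDiff, hm₁, hm₂]
    exact Or.inl ⟨Or.inl hg, fun h => h.elim (hd g hg) fun h => hd₁ g hg (hA₂ h)⟩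
  have hB₂H : B₂ ⊆ symmDiff Z₁ Z₂ := fun g hg => by
    rw [Finset.mem_symmDiff, hm₁, hm₂]
    exact Or.inr ⟨Or.inl hg, fun h => h.elim (fun h => hd g h hg) fun h => hd₂ g hg (hA₁ h)⟩
  have hHU : symmDiff Z₁ Z₂ ⊆ C ∪ B₁ ∪ B₂ := by
    intro g hg
    have := @hA₁ g
    have := @hA₂ g
    simp only [Finset.mem_symmDiff, Finset.mem_union, hm₁, hm₂] at hg ⊢
    tauto
  have hrH := hB₁H hr
  have heH : e ∉ symmDiff Z₁ Z₂ := by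
    rw [Finset.mem_symmDiff, hm₁, hm₂]
    tauto
  have hrZ₂ : r ∉ Z₂ := fun h => ((hm₂ r).1 h).elim (hd r hr) fun h => hd₁ r hr (hA₂ h)
  have heY : ∀ Y₁ Y₂, (Y₁ = ∅ ∨ Y₁ = Z₁) → (Y₂ = ∅ ∨ Y₂ = Z₂) → e ∉ symmDiff Y₁ Y₂ := by
    intro Y₁ Y₂ h₁ h₂ h
    rcases Finset.mem_symmDiff.1 h with ⟨h, -⟩ | ⟨h, -⟩
    · rcases h₁ with rfl | rfl
      · simp at h
      · exact ((hm₁ e).1 h).elim heB₁ heA₁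
    · rcases h₂ with rfl | rfl
      · simp at h
      · exact ((hm₂ e).1 h).elim heB₂ heA₂
  have hcirc : IsCircleOf G (symmDiff Z₁ Z₂) := by
    obtain ⟨Z, hZ, hrZ, hZH⟩ :=
      exists_isCircleOf_of_edgeBoundary_eq_zero (fun g hg => hU g (hHU hg)) hH0 hrH
    obtain ⟨Y₁, Y₂, hY₁, hY₂, rfl | rfl⟩ :=
      hspan Z (edgeBoundary_eq_zero_of_isCircleOf hZ) (hZH.trans hHU)
    · obtain rfl : Y₁ = Z₁ := hY₁.resolve_left <| by
        rintro rfl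
        rcases hY₂ with rfl | rfl
        all_goals simp [Finset.mem_symmDiff, hrZ₂] at hrZ
      obtain rfl | rfl := hY₂.symm
      · exact hZ
      have hdA : ∀ x ∈ A₁, x ∉ A₂ := fun x h1 h2 => by
        have := @hZH x (by simp [Finset.mem_symmDiff, hm₁, h1])
        simp [Finset.mem_symmDiff, hm₁, hm₂, h1, h2] at this
      have hA₁H : A₁ ⊆ symmDiff Y₁ Z₂ := fun x hx => by
        have h1 : x ∉ B₂ := fun h => hd₂ x h (hA₁ hx)
        simp [Finset.mem_symmDiff, hm₁, hm₂, hx, hdA x hx, h1]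
      have hA₂H : A₂ ⊆ symmDiff Y₁ Z₂ := fun x hx => by
        have h1 : x ∉ B₁ := fun h => hd₁ x h (hA₂ hx)
        have h2 : x ∉ A₁ := fun h => hdA x h hx
        simp [Finset.mem_symmDiff, hm₁, hm₂, hx, h2, h1]
      have hW0 : edgeBoundary (symmDiff (symmDiff Y₁ Z₂) C) = 0 := by
        rw [edgeBoundary_symmDiff, hH0, hC0, add_zero]
      have hWU : symmDiff (symmDiff Y₁ Z₂) C ⊆ C ∪ B₁ ∪ B₂ := fun g hg => by
        rcases Finset.mem_symmDiff.1 hg with h | h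
        · exact hHU h.1
        · simp [h.1]
      obtain ⟨K, hK, heK, hKW⟩ := exists_isCircleOf_of_edgeBoundary_eq_zero
        (fun g hg => hU g (hWU hg)) hW0 (Finset.mem_symmDiff.2 (Or.inr ⟨heC, heH⟩))
      have hnot : ∀ x ∈ K, x ∈ C → x ∉ symmDiff Y₁ Z₂ := fun x hx hxC h => by
        simpa [hxC, h] using Finset.mem_symmDiff.1 (hKW hx)
      obtain ⟨a₁, ha₁⟩ := hne₁
      obtain ⟨a₂, ha₂⟩ := hne₂
      exfalso
      obtain ⟨X₁, X₂, hX₁, hX₂, rfl | rfl⟩ :=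
        hspan K (edgeBoundary_eq_zero_of_isCircleOf hK) (hKW.trans hWU)
      · exact heY _ _ hX₁ hX₂ heK
      rcases hX₁ with rfl | rfl
      · refine hnot a₁ ?_ (hA₁ ha₁) (hA₁H ha₁)
        have h1 : a₁ ∉ B₂ := fun h => hd₂ _ h (hA₁ ha₁)
        rcases hX₂ with rfl | rfl
        all_goals simp [Finset.mem_symmDiff, hm₂, hA₁ ha₁, hdA a₁ ha₁, h1]
      · rcases hX₂ with rfl | rfl
        · refine hnot a₂ ?_ (hA₂ ha₂) (hA₂H ha₂)
          have h1 : a₂ ∉ B₁ := fun h => hd₁ _ h (hA₂ ha₂)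
          have h2 : a₂ ∉ A₁ := fun h => hdA _ h ha₂
          simp [Finset.mem_symmDiff, hm₁, hA₂ ha₂, h1, h2]
        · have h1 := hCu _ hK heK (by rw [esign_symmDiff, hHs, hCs, mul_one])
          refine hd₁ r hr (h1 ▸ Finset.mem_symmDiff.2 (Or.inl ⟨hrH, hd₁ r hr⟩))
    · exact absurd (hZH (Finset.mem_symmDiff.2 (Or.inr ⟨heC, heY _ _ hY₁ hY₂⟩))) heH
  refine ⟨_, hcirc, hHs, hB₁H, hB₂H, hHU, ?_⟩
  rintro t ht hts htU ⟨g, hgt, hg⟩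
  have hgZ₂ : g ∉ Z₂ := fun h => ((hm₂ g).1 h).elim (hd g hg) fun h => hd₁ g hg (hA₂ h)
  obtain ⟨Y₁, Y₂, hY₁, hY₂, rfl | rfl⟩ := hspan t (edgeBoundary_eq_zero_of_isCircleOf ht) htU
  · rcases hY₁ with rfl | rfl
    · rcases hY₂ with rfl | rfl
      all_goals simp [Finset.mem_symmDiff, hgZ₂] at hgt
    · rcases hY₂ with rfl | rfl
      · rw [← Finset.bot_eq_empty, symmDiff_bot, hs₁'] at hts
        exact absurd hts (by decide)
      · rfl
  · have h1 := hCu _ ht (Finset.mem_symmDiff.2 (Or.inr ⟨heC, heY _ _ hY₁ hY₂⟩)) hts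
    exact absurd (h1 ▸ hgt) (hd₁ g hg)

lemma exists_mem_edges_of_ne {p : G.Walk x y} (hne : p.edges ≠ []) {z : V}
    (hz : z ∈ p.support) : ∃ g ∈ p.edges, z ∈ g := by
  refine (Walk.mem_support_iff_exists_mem_edges_of_not_nil fun h => hne ?_).1 hz
  exact Walk.edges_eq_nil.2 h

lemma esign_edges {p : G.Walk x y} (hp : p.IsTrail) : esign σ p.edges.toFinset = wsign σ p :=
  List.prod_toFinset σ hp.edges_nodup

variable {F F₁ F₂ : Set (Sym2 V)}

lemma IsBridgeOf.isHandle (hF : IsBridgeOf G w F) (hR : IsEar {z | z ∈ w.support} R)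
    (hRF : ∀ g ∈ R.edges, g ∈ F) : IsHandle w R :=
  ⟨hR, fun g hg => hF.notMem_edges (hRF g hg)⟩

lemma IsBridgeOf.areDisjointHandles (hF₁ : IsBridgeOf G w F₁) (hF₂ : IsBridgeOf G w F₂)
    (h₁₂ : F₁ ≠ F₂) (hR₁ : IsEar {z | z ∈ w.support} R₁) (hR₂ : IsEar {z | z ∈ w.support} R₂)
    (hRF₁ : ∀ g ∈ R₁.edges, g ∈ F₁) (hRF₂ : ∀ g ∈ R₂.edges, g ∈ F₂) :
    AreDisjointHandles w R₁ R₂ where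
  left := hF₁.isHandle hR₁ hRF₁
  right := hF₂.isHandle hR₂ hRF₂
  disjoint g hg₁ hg₂ := h₁₂ (hF₁.eq_of_mem hF₂ (hRF₁ g hg₁) (hRF₂ g hg₂))
  inter z hz₁ hz₂ := by
    by_contra hz
    obtain ⟨g₁, hg₁, hzg₁⟩ := exists_mem_edges_of_ne hR₁.edges_ne_nil hz₁
    obtain ⟨g₂, hg₂, hzg₂⟩ := exists_mem_edges_of_ne hR₂.edges_ne_nil hz₂
    exact h₁₂ (hF₁.eq_of_mem hF₂ (hF₁.isClosedOff z hz g₁ (hRF₁ g₁ hg₁) hzg₁ g₂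
      (R₂.edges_subset_edgeSet hg₂) hzg₂) (hRF₂ g₂ hg₂))

lemma IsBridgeOf.exists_isEar (hG : IsBlock G) (hw : w.IsCycle) (hF : IsBridgeOf G w F)
    {g : Sym2 V} (hg : g ∈ F) : ∃ (x y : V) (R : G.Walk x y), IsEar {z | z ∈ w.support} R ∧
      g ∈ R.edges ∧ ∀ g' ∈ R.edges, g' ∈ F := by
  have hS : {z | z ∈ w.support}.Nontrivial := by
    cases w with
    | nil => simp at hw
    | @cons _ v _ h p => exact ⟨a, by simp, v, by simp, h.ne⟩
  obtain ⟨x, y, R, hR, hgR⟩ := hG.exists_isEar hS (hF.subset_edgeSet hg)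
  exact ⟨x, y, R, hR, hgR, hF.isClosedOff.edges_subset hR hgR hg⟩

lemma IsFan.mem_edges_of_forall (hG : IsBlock G) (hw : w.IsCycle)
    (he : IsPositiveBattery G σ w.edges.toFinset e) (hF : IsBridgeOf G w F) {f : Sym2 V}
    (hfF : f ∈ F)
    (hF' : ∀ t, IsCircleOf G t → f ∈ t → esign σ t = 1 → ∃ g ∈ t, g ∉ F) {z c : V}
    {p : G.Walk z x} {q : G.Walk z y} (hpq : IsFan {z | z ∈ w.support} p q) (hf : f ∈ p.edges)
    (hmax : ∀ {x y : V} (R : G.Walk x y), IsEar {z | z ∈ w.support} R → f ∈ R.edges →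
      ∀ g ∈ R.edges, g ∈ p.edges ∨ g ∈ q.edges) (hzc : G.Adj z c) :
    s(z, c) ∈ p.edges ∨ s(z, c) ∈ q.edges := by
  by_contra hc
  obtain ⟨t, T, hT, heT, ht, htz, hTT⟩ := hG.exists_isPath_through
    (T := {r | r ∈ w.support ∨ r ∈ p.support ∨ r ∈ q.support}) hzc (Or.inl hpq.left)
    (fun h => hpq.notMem (h ▸ hpq.left))
  by_cases htq : t ∈ q.support
  · obtain ⟨q₁, q₂, rfl⟩ := Walk.mem_support_iff_exists_append.1 htq
    exact hc (hmax _ (hpq.append_dropUntil hT htz hTT).isEar (by simp [hf]) _ (by simp [heT]))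
  by_cases htp : t ∈ p.support
  swap
  · exact hc (hmax _ (hpq.replace_right hT ((ht.resolve_right fun h => h.elim htp htq)) htp
      hTT).isEar (by simp [hf]) _ (by simp [heT]))
  obtain ⟨p₁, p₂, rfl⟩ := Walk.mem_support_iff_exists_append.1 htp
  have hpF := hF.isClosedOff.edges_subset hpq.isEar (by simp at hf ⊢; tauto) hfF
  have hfan := (hpq.symm.append_dropUntil hT htz fun r hr h => hTT r hr (by
    rcases h with h | h | h
    · exact Or.inl h
    · exact Or.inr (Or.inr h)
    · exact Or.inr (Or.inl h))).symm
  have hqn : q.edges ≠ [] := by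
    cases q with
    | nil => exact absurd hpq.right hpq.notMem
    | cons => simp
  obtain ⟨k, hk⟩ := List.exists_mem_of_ne_nil _ hqn
  have hTF := hF.isClosedOff.edges_subset hfan.isEar (g := k) (by simp [hk])
    (hpF k (by simp [hk]))
  have hfT : f ∉ ((T.append p₂).reverse.append q).edges := fun h =>
    hc (hmax _ hfan.isEar h _ (by simp [heT]))
  simp only [Walk.edges_append, Walk.edges_reverse, List.mem_append, List.mem_reverse,
    not_or] at hfT hf
  have hfp := hf.resolve_right hfT.1.2
  have hp₁ := hpq.left_isPath.of_append_left
  have hTp : ∀ r ∈ T.support, r ∈ p₁.support → r = z ∨ r = t := fun r hr hr' =>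
    hTT r hr (Or.inr (Or.inl (by simp [hr'])))
  have hsign : wsign σ T = wsign σ p₁ := by
    have hR := hF.isHandle hpq.isEar hpF
    have hR' := hF.isHandle hfan.isEar hTF
    obtain ⟨A, hA, hAR, -⟩ := hR.exists_arc hw e
    have h1 := hR.esign_mul hw he hA hAR
    have h2 := hR'.esign_mul hw he hA (by
      rw [hAR, edgeBoundary_edges hR.isPath.isTrail, edgeBoundary_edges hR'.isPath.isTrail])
    rw [← h2, esign_edges hR.isPath.isTrail, esign_edges hR'.isPath.isTrail] at h1
    simpa [wsign] using h1.symm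
  have hZ0 : edgeBoundary (symmDiff T.edges.toFinset p₁.edges.toFinset) = 0 := by
    rw [edgeBoundary_symmDiff, edgeBoundary_edges hT.isTrail, edgeBoundary_edges hp₁.isTrail,
      ZMod.pi_add_self]
  have hZ : ∀ g ∈ symmDiff T.edges.toFinset p₁.edges.toFinset, g ∈ T.edges ∨ g ∈ p₁.edges := by
    intro g hg
    rw [Finset.mem_symmDiff, List.mem_toFinset, List.mem_toFinset] at hg
    tauto
  obtain ⟨K, hK, hfK, hKZ⟩ := exists_isCircleOf_of_edgeBoundary_eq_zero (G := G) (fun g hg =>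
    (hZ g hg).elim (T.edges_subset_edgeSet ·) (p₁.edges_subset_edgeSet ·)) hZ0 (g := f)
    (by simp [Finset.mem_symmDiff, hfp, hfT.1.1])
  have hK0 := edgeBoundary_eq_zero_of_isCircleOf hK
  have hp₁K : p₁.edges.toFinset ⊆ K := by
    refine (disjoint_or_edges_subset hp₁ hK0 fun r hr hrz hrt g hg hrg => ?_).resolve_left
      fun h => Finset.disjoint_left.1 h hfK (by simpa using hfp)
    refine (hZ g (hKZ hg)).resolve_left fun h => ?_
    exact (hTp r (T.mem_support_of_mem_edges h hrg) hr).elim hrz hrt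
  have hTK : T.edges.toFinset ⊆ K := by
    refine (disjoint_or_edges_subset hT hK0 fun r hr hrz hrt g hg hrg => ?_).resolve_left
      fun h => ?_
    · refine (hZ g (hKZ hg)).resolve_right fun h => ?_
      exact (hTp r hr (p₁.mem_support_of_mem_edges h hrg)).elim hrz hrt
    · refine single_add_single_ne_zero htz ?_
      rw [add_comm, ← edgeBoundary_edges hp₁.isTrail, ← hK0]
      congr 1
      refine hp₁K.antisymm fun g hg => ?_
      have := (hZ g (hKZ hg)).resolve_left fun h1 =>
        Finset.disjoint_left.1 h hg (by simpa using h1)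
      simpa using this
  have hKZ' : K = symmDiff T.edges.toFinset p₁.edges.toFinset :=
    hKZ.antisymm fun g hg => (hZ g hg).elim (fun h => hTK (by simpa using h))
      fun h => hp₁K (by simpa using h)
  obtain ⟨g, hg, hgF⟩ := hF' K hK hfK (by
    rw [hKZ', esign_symmDiff, esign_edges hT.isTrail, esign_edges hp₁.isTrail, hsign,
      Int.units_mul_self])
  exact hgF ((hZ g (hKZ hg)).elim (fun h => hTF g (by simp [h])) fun h => hpF g (by simp [h]))

/-- If an edge of one of two bridges of `w` is in at most one positive circle, both bridges are
paths. -/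
lemma IsBridgeOf.exists_isPath_of_forall_eq (hG : IsBlock G) (hw : w.IsCycle)
    (he : IsPositiveBattery G σ w.edges.toFinset e) (hF₁ : IsBridgeOf G w F₁)
    (hF₂ : IsBridgeOf G w F₂) (h₁₂ : F₁ ≠ F₂) {f : Sym2 V} (hf : f ∈ F₁)
    {s : Finset (Sym2 V)}
    (hs : ∀ t, IsCircleOf G t → f ∈ t → esign σ t = 1 → t = s) :
    (∃ (x y : V) (Q : G.Walk x y), Q.IsPath ∧ ∀ g : Sym2 V, g ∈ Q.edges ↔ g ∈ F₁) ∧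
      ∃ (x y : V) (Q : G.Walk x y), Q.IsPath ∧ ∀ g : Sym2 V, g ∈ Q.edges ↔ g ∈ F₂ := by
  have key : ∀ {x₁ y₁ x₂ y₂ : V} {R₁ : G.Walk x₁ y₁} {R₂ : G.Walk x₂ y₂},
      IsEar {z | z ∈ w.support} R₁ → IsEar {z | z ∈ w.support} R₂ → f ∈ R₁.edges →
      (∀ g ∈ R₁.edges, g ∈ F₁) → (∀ g ∈ R₂.edges, g ∈ F₂) →
      (∀ g ∈ R₁.edges, g ∈ s) ∧ (∀ g ∈ R₂.edges, g ∈ s) ∧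
      (∀ g ∈ s, g ∈ F₁ → g ∈ R₁.edges) ∧ ∀ g ∈ s, g ∈ F₂ → g ∈ R₂.edges := by
    intro x₁ y₁ x₂ y₂ R₁ R₂ hR₁ hR₂ hfR h1 h2
    obtain ⟨H, hH, hHs, hH₁, hH₂, hHU, -⟩ :=
      (hF₁.areDisjointHandles hF₂ h₁₂ hR₁ hR₂ h1 h2).exists_isCircleOf hw he
    obtain rfl := hs H hH (hH₁ (by simpa using hfR)) hHs
    refine ⟨fun g hg => hH₁ (by simpa using hg), fun g hg => hH₂ (by simpa using hg), ?_, ?_⟩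
    all_goals
      intro g hg hgF
      have := hHU hg
      simp only [Finset.mem_union, List.mem_toFinset] at this
    · rcases this with (h | h) | h
      · exact absurd h (hF₁.notMem_edges hgF)
      · exact h
      · exact absurd (hF₁.eq_of_mem hF₂ hgF (h2 g h)) h₁₂
    · rcases this with (h | h) | h
      · exact absurd h (hF₂.notMem_edges hgF)
      · exact absurd (hF₁.eq_of_mem hF₂ (h1 g h) hgF) h₁₂
      · exact h
  obtain ⟨k, hk⟩ := hF₂.nonempty hG.1
  obtain ⟨x₁, y₁, R₁, hR₁, hfR, h1⟩ := hF₁.exists_isEar hG hw hf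
  obtain ⟨x₂, y₂, R₂, hR₂, hkR, h2⟩ := hF₂.exists_isEar hG hw hk
  obtain ⟨h3, h4, h5, h6⟩ := key hR₁ hR₂ hfR h1 h2
  refine ⟨⟨x₁, y₁, R₁, hR₁.isPath, fun g => ⟨h1 g, fun hg => ?_⟩⟩,
    ⟨x₂, y₂, R₂, hR₂.isPath, fun g => ⟨h2 g, fun hg => ?_⟩⟩⟩
  · refine hF₁.subset_of_isClosedOff (F' := {g | g ∈ R₁.edges}) ?_ hf hfR hg
    clear g hg
    intro z hz g hg hzg g' hg' hzg'
    have hF' : ∀ t, IsCircleOf G t → f ∈ t → esign σ t = 1 → ∃ g ∈ t, g ∉ F₁ :=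
      fun t ht hft hts => ⟨k, hs t ht hft hts ▸ h4 k hkR, fun h => h₁₂ (hF₁.eq_of_mem hF₂ h hk)⟩
    have hmax : ∀ {x y : V} (R : G.Walk x y), IsEar {z | z ∈ w.support} R → f ∈ R.edges →
        ∀ g ∈ R.edges, g ∈ R₁.edges := fun R hR hfR' g hg => by
      have h7 := hF₁.isClosedOff.edges_subset hR hfR' hf
      exact h5 g ((key hR hR₂ hfR' h7 h2).1 g hg) (h7 g hg)
    obtain ⟨p, q, hpq, rfl⟩ := hR₁.exists_isFan (R₁.mem_support_of_mem_edges hg hzg) hz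
    obtain ⟨c, rfl⟩ := Sym2.mem_iff_exists.1 hzg'
    simp only [Walk.edges_append, Walk.edges_reverse, List.mem_append, List.mem_reverse,
      Set.mem_ofPred_eq] at hfR hmax ⊢
    rcases hfR with h | h
    · exact hpq.mem_edges_of_forall hG hw he hF₁ hf hF' h hmax hg'
    · exact (hpq.symm.mem_edges_of_forall hG hw he hF₁ hf hF' h
        (fun R hR hf g hg => (hmax R hR hf g hg).symm) hg').symm
  · obtain ⟨x, y, R, hR, hgR, h7⟩ := hF₂.exists_isEar hG hw hg
    exact h6 g ((key hR₁ hR hfR h1 h7).2.1 g hgR) hg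

/-- If the circle has just two bridges and both are paths, every edge of a bridge is in a unique
positive circle. -/
lemma IsBridgeOf.existsUnique_isCircleOf (hG : IsBlock G) (hw : w.IsCycle)
    (he : IsPositiveBattery G σ w.edges.toFinset e) (hF₁ : IsBridgeOf G w F₁)
    (hF₂ : IsBridgeOf G w F₂) (h₁₂ : F₁ ≠ F₂)
    (honly : ∀ F : Set (Sym2 V), IsBridgeOf G w F → F = F₁ ∨ F = F₂)
    {Q₁ : G.Walk x₁ y₁} (hQ₁ : Q₁.IsPath) (hQF₁ : ∀ g, g ∈ Q₁.edges ↔ g ∈ F₁)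
    {Q₂ : G.Walk x₂ y₂} (hQ₂ : Q₂.IsPath) (hQF₂ : ∀ g, g ∈ Q₂.edges ↔ g ∈ F₂)
    {f : Sym2 V} (hf : f ∈ F₁) :
    ∃! s : Finset (Sym2 V), IsCircleOf G s ∧ f ∈ s ∧ esign σ s = 1 := by
  obtain ⟨k, hk⟩ := hF₂.nonempty hG.1
  obtain ⟨u₁, v₁, R₁, hR₁, hfR, h1⟩ := hF₁.exists_isEar hG hw hf
  obtain ⟨u₂, v₂, R₂, hR₂, hkR, h2⟩ := hF₂.exists_isEar hG hw hk
  have h3 := hF₁.subset_edges_of_isPath hQ₁ hQF₁ hR₁ hfR hf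
  have h4 := hF₂.subset_edges_of_isPath hQ₂ hQF₂ hR₂ hkR hk
  obtain ⟨H, hH, hHs, hH₁, -, -, hu⟩ :=
    (hF₁.areDisjointHandles hF₂ h₁₂ hR₁ hR₂ h1 h2).exists_isCircleOf hw he
  refine ⟨H, ⟨hH, hH₁ (by simpa using hfR), hHs⟩, ?_⟩
  rintro t ⟨ht, hft, hts⟩
  refine hu t ht hts (fun g hg => ?_) ⟨f, hft, hfR⟩
  simp only [Finset.mem_union, List.mem_toFinset]
  by_cases hgw : g ∈ w.edges
  · exact Or.inl (Or.inl hgw)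
  · have hgG : g ∈ G.edgeSet := by
      obtain ⟨b, c, -, rfl⟩ := ht
      exact c.edges_subset_edgeSet (by simpa using hg)
    obtain ⟨F, hF, hgF⟩ := exists_isBridgeOf w hgG hgw
    rcases honly F hF with rfl | rfl
    · exact Or.inl (Or.inr (h3 g hgF))
    · exact Or.inr (h4 g hgF)

end Handles

theorem two_bridges_positive_batteries {V : Type*} [DecidableEq V]
    (G : SimpleGraph V) (σ : Sym2 V → ℤˣ) (hG : IsBlock G)
    {a : V} (w : G.Walk a a) (hw : w.IsCycle)
    (hnc : ∃ g ∈ G.edgeSet, g ∉ w.edges)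
    -- `e` is a positive battery with unique positive circle `C`:
    (e : Sym2 V) (he : e ∈ w.edges)
    (hbat : esign σ w.edges.toFinset = 1 ∧
      ∀ s : Finset (Sym2 V), IsCircleOf G s → e ∈ s → esign σ s = 1 →
        s = w.edges.toFinset)
    -- `C` has exactly two bridges `F₁ ≠ F₂`:
    (F₁ F₂ : Set (Sym2 V)) (hF₁ : IsBridgeOf G w F₁) (hF₂ : IsBridgeOf G w F₂)
    (h₁₂ : F₁ ≠ F₂)
    (honly : ∀ F : Set (Sym2 V), IsBridgeOf G w F → F = F₁ ∨ F = F₂) :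
    -- if both bridges are paths, every edge of either bridge is a positive
    -- battery; otherwise no edge of either bridge is a positive battery:
    ((∃ (x y : V) (Q : G.Walk x y), Q.IsPath ∧ ∀ g : Sym2 V, g ∈ Q.edges ↔ g ∈ F₁) ∧
     (∃ (x y : V) (Q : G.Walk x y), Q.IsPath ∧ ∀ g : Sym2 V, g ∈ Q.edges ↔ g ∈ F₂) →
      ∀ f, f ∈ F₁ ∪ F₂ →
        ∃! s : Finset (Sym2 V), IsCircleOf G s ∧ f ∈ s ∧ esign σ s = 1) ∧
    (¬ ((∃ (x y : V) (Q : G.Walk x y), Q.IsPath ∧ ∀ g : Sym2 V, g ∈ Q.edges ↔ g ∈ F₁) ∧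
        (∃ (x y : V) (Q : G.Walk x y), Q.IsPath ∧ ∀ g : Sym2 V, g ∈ Q.edges ↔ g ∈ F₂)) →
      ∀ f, f ∈ F₁ ∪ F₂ →
        ¬ ∃! s : Finset (Sym2 V), IsCircleOf G s ∧ f ∈ s ∧ esign σ s = 1) := by
  have hb : IsPositiveBattery G σ w.edges.toFinset e := ⟨by simpa using he, hbat.1, hbat.2⟩
  have honly' : ∀ F : Set (Sym2 V), IsBridgeOf G w F → F = F₂ ∨ F = F₁ :=
    fun F hF => (honly F hF).symm
  refine ⟨?_, fun h f hf => ?_⟩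
  · rintro ⟨⟨x₁, y₁, Q₁, hQ₁, hQF₁⟩, x₂, y₂, Q₂, hQ₂, hQF₂⟩ f (hf | hf)
    · exact hF₁.existsUnique_isCircleOf hG hw hb hF₂ h₁₂ honly hQ₁ hQF₁ hQ₂ hQF₂ hf
    · exact hF₂.existsUnique_isCircleOf hG hw hb hF₁ h₁₂.symm honly' hQ₂ hQF₂ hQ₁ hQF₁ hf
  · rintro ⟨s, -, hs⟩
    have hs' : ∀ t, IsCircleOf G t → f ∈ t → esign σ t = 1 → t = s :=
      fun t ht hft hts => hs t ⟨ht, hft, hts⟩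
    rcases hf with hf | hf
    · exact h (hF₁.exists_isPath_of_forall_eq hG hw hb hF₂ h₁₂ hf hs')
    · exact h (hF₂.exists_isPath_of_forall_eq hG hw hb hF₁ h₁₂.symm hf hs').symm
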